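/- For each n, let l_n ∈ {1,…,n} be arbitrary, and let X_{n,l_n} be the depth of the node containing l_n in the random binary search tree built from a uniformly random permutation of {1,…,n}. Then (X_{n,l_n} − E X_{n,l_n}) / √(E X_{n,l_n}) converges in distribution to the standard normal distribution as n → ∞; that is, for every x ∈ ℝ, P((X_{n,l_n} − E X_{n,l_n})/√(E X_{n,l_n}) ≤ x) → Φ(x), where Φ is the standard normal cumulative distribution function. -/

import Mathlib

open MeasureTheory ProbabilityTheory Finset Filter
open scoped ENNReal NNReal

noncomputable section

/-- The `k`-th harmonic number `H_k = ∑_{i=1}^k 1/i`, with `H_0 = 0`. -/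
def harm (k : ℕ) : ℝ := ∑ i ∈ Finset.range k, (1 : ℝ) / (i + 1)

instance (n : ℕ) : MeasurableSpace (Equiv.Perm (Fin n)) := ⊤

/-- The uniform distribution on the permutations of `{1,…,n}`. -/
def uniformPerm (n : ℕ) : Measure (Equiv.Perm (Fin n)) :=
  (PMF.uniformOfFintype (Equiv.Perm (Fin n))).toMeasure

/-- The (1-based) position `N = π⁻¹(l)` of the key `l` in the permutation `π`
(positions are `i+1` for `i : Fin n`, values are `π i + 1`). -/
def bstN (n l : ℕ) (π : Equiv.Perm (Fin n)) : ℕ :=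
  1 + ∑ i : Fin n, if (π i : ℕ) + 1 = l then (i : ℕ) else 0

open scoped Classical in
/-- `R₋`: the number of ascending records in the subpermutation of values `< l`
appearing before the position of `l`. -/
def bstRminus (n l : ℕ) (π : Equiv.Perm (Fin n)) : ℕ :=
  (Finset.univ.filter fun r : Fin n =>
    (r : ℕ) + 1 < bstN n l π ∧ (π r : ℕ) + 1 < l ∧
      ∀ k : Fin n, k < r → (π k : ℕ) + 1 < l → π k < π r).card

open scoped Classical in
/-- `R₊`: the number of descending records in the subpermutation of values `> l`
appearing before the position of `l`. -/
def bstRplus (n l : ℕ) (π : Equiv.Perm (Fin n)) : ℕ :=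
  (Finset.univ.filter fun r : Fin n =>
    (r : ℕ) + 1 < bstN n l π ∧ (π r : ℕ) + 1 > l ∧
      ∀ k : Fin n, k < r → (π k : ℕ) + 1 > l → π r < π k).card

/-- `X_{n,l} = R₋ + R₊`: the depth of the node containing `l` in the binary search
tree built from the permutation `π` of `{1,…,n}`. -/
def bstDepth (n l : ℕ) (π : Equiv.Perm (Fin n)) : ℕ :=
  bstRminus n l π + bstRplus n l π

open scoped Classical in
/-- `G = #{1 ≤ i < N : π(i) < l}`. -/
def bstG (n l : ℕ) (π : Equiv.Perm (Fin n)) : ℕ :=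
  (Finset.univ.filter fun i : Fin n =>
    (i : ℕ) + 1 < bstN n l π ∧ (π i : ℕ) + 1 < l).card

/-- The expectation `E X_{n,l}` of the depth of the node containing `l`. -/
def bstExp (n l : ℕ) : ℝ := ∫ π, (bstDepth n l π : ℝ) ∂(uniformPerm n)

/-- The hypergeometric probability mass function: for `X ~ HypGeo(N; M, n)`,
`P(X = k) = C(M,k)·C(N−M,n−k)/C(N,n)` for `0 ≤ k ≤ n` (and `0` otherwise). -/
def hypPMF (N M n k : ℕ) : ℝ :=
  if k ≤ n then (M.choose k * (N - M).choose (n - k) : ℝ) / (N.choose n) else 0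

/-- Total variation distance between (probability) measures on `ℕ`. -/
def dTV (μ ν : Measure ℕ) : ℝ := ⨆ A : Set ℕ, |(μ A).toReal - (ν A).toReal|

/-- The Wasserstein-type distance `d_W` of Barbour–Holst–Janson: the supremum of
`|∫ f dμ − ∫ f dν|` over measurable `f` with `|f(x) − f(y)| ≤ 1` whenever `|x − y| ≤ 1`. -/
def dW (μ ν : Measure ℝ) : ℝ :=
  sSup { d : ℝ | ∃ f : ℝ → ℝ, Measurable f ∧ (∀ x y, |x - y| ≤ 1 → |f x - f y| ≤ 1) ∧
    d = |∫ x, f x ∂μ - ∫ x, f x ∂ν| }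

/-- The mixed Poisson distribution with mixing measure `ν`:
`MixPo(ν)({k}) = ∫ e^{−λ} λ^k / k! ν(dλ)`. -/
def mixPo (ν : Measure ℝ) : Measure ℕ :=
  Measure.sum fun k =>
    (∫⁻ l, ENNReal.ofReal (Real.exp (-l) * l ^ k / k.factorial) ∂ν) • Measure.dirac k

/-- The standard normal cumulative distribution function `Φ`. -/
def stdNormalCDF (x : ℝ) : ℝ :=
  (1 / Real.sqrt (2 * Real.pi)) * ∫ y in Set.Iic x, Real.exp (-y ^ 2 / 2)

end

/-- The number of `j` such that `s j` is smaller than every later term of the sequence `s`. -/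
def numRecords {α : Type*} [LinearOrder α] {m : ℕ} (s : Fin m → α) : ℕ :=
  (Finset.univ.filter fun j : Fin m => ∀ i, j < i → s j < s i).card

theorem numRecords_succ {α : Type*} [LinearOrder α] {m : ℕ} (s : Fin (m + 1) → α) :
    numRecords s = numRecords (s ∘ Fin.succ) + if ∀ i : Fin m, s 0 < s i.succ then 1 else 0 := by
  simp only [numRecords, Finset.card_filter, Fin.sum_univ_succ, Fin.forall_fin_succ,
    Function.comp_apply, Fin.succ_lt_succ_iff, Fin.succ_pos, Fin.not_lt_zero,
    false_imp_iff, true_imp_iff, true_and]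
  rw [add_comm]

theorem numRecords_castSucc_le {α : Type*} [LinearOrder α] {m : ℕ} (s : Fin (m + 1) → α) :
    numRecords s ≤ numRecords (s ∘ Fin.castSucc) + 1 := by
  simp only [numRecords, Finset.card_filter, Fin.sum_univ_castSucc]
  refine Nat.add_le_add (Finset.sum_le_sum fun j _ => ?_) (by split_ifs <;> simp)
  split_ifs with h₁ h₂
  · exact le_rfl
  · exact absurd (fun i hi => h₁ (Fin.castSucc i) (by simpa using hi)) h₂
  · simp
  · exact le_rfl

/-- The mean of `f R`, where `R` is the number of records of a uniformly random arrangement of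
`m` distinct values, computed by inserting the values one at a time. -/
noncomputable def recordMean : (m : ℕ) → (ℕ → ℂ) → ℂ
  | 0, f => f 0
  | m + 1, f => (m * recordMean m f + recordMean m fun k => f (k + 1)) / (m + 1)

theorem recordMean_pow (m : ℕ) (z : ℂ) :
    recordMean m (fun k => z ^ k) = ∏ i ∈ Finset.range m, (1 + (z - 1) / (i + 1)) := by
  suffices h : ∀ c : ℂ, recordMean m (fun k => c * z ^ k) =
      c * ∏ i ∈ Finset.range m, (1 + (z - 1) / (i + 1)) by simpa using h 1
  induction m with
  | zero => simp [recordMean]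
  | succ m ih =>
    intro c
    have hm : (m : ℂ) + 1 ≠ 0 := by exact_mod_cast m.succ_ne_zero
    have h := ih (c * z)
    simp only [recordMean, Finset.prod_range_succ, ih c, pow_succ', ← mul_assoc, h]
    field_simp
    ring

theorem recordMean_natCast (m : ℕ) : recordMean m (fun k => (k : ℂ)) = harm m := by
  suffices h : ∀ c : ℂ, recordMean m (fun k => k + c) = harm m + c by simpa using h 0
  induction m with
  | zero => simp [recordMean, harm]
  | succ m ih =>
    intro c
    have hm : (m : ℂ) + 1 ≠ 0 := by exact_mod_cast m.succ_ne_zero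
    have h := ih (1 + c)
    simp only [← add_assoc] at h
    have hs : harm (m + 1) = harm m + 1 / (m + 1) := by simp [harm, Finset.sum_range_succ]
    simp only [recordMean, ih c, Nat.cast_add, Nat.cast_one, h, hs]
    push_cast
    field_simp
    ring

theorem sum_perm_numRecords {α : Type*} [LinearOrder α] {m : ℕ} {s : Fin m → α}
    (hs : Function.Injective s) (f : ℕ → ℂ) :
    ∑ h : Equiv.Perm (Fin m), f (numRecords (s ∘ h)) = m.factorial * recordMean m f := by
  induction m generalizing f with
  | zero => simp [recordMean, numRecords]
  | succ m ih =>
    obtain ⟨p₀, -, hp₀⟩ := Finset.exists_min_image Finset.univ s Finset.univ_nonempty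
    have hm : (m : ℂ) + 1 ≠ 0 := by exact_mod_cast m.succ_ne_zero
    have key : ∀ p : Fin (m + 1), ∑ h : Equiv.Perm (Fin m),
        f (numRecords (s ∘ Equiv.Perm.decomposeFin.symm (p, h))) =
          m.factorial * if p = p₀ then recordMean m (fun k => f (k + 1)) else recordMean m f := by
      intro p
      have ht : Function.Injective (s ∘ Equiv.swap 0 p ∘ Fin.succ) :=
        hs.comp ((Equiv.injective _).comp (Fin.succ_injective m))
      have hrec : ∀ h : Equiv.Perm (Fin m),
          numRecords (s ∘ Equiv.Perm.decomposeFin.symm (p, h)) =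
            numRecords ((s ∘ Equiv.swap 0 p ∘ Fin.succ) ∘ h) + if p = p₀ then 1 else 0 := by
        intro h
        rw [numRecords_succ]
        congr 1
        · congr 1
          ext i
          simp
        · refine if_congr ⟨fun H => ?_, ?_⟩ rfl rfl
          · by_contra hne
            obtain ⟨q, hq⟩ := (Equiv.Perm.decomposeFin.symm (p, h)).surjective p₀
            rcases Fin.eq_zero_or_eq_succ q with rfl | ⟨i, rfl⟩
            · exact hne (by simpa using hq)
            · have := H i
              simp only [Function.comp_apply, hq, Equiv.Perm.decomposeFin_symm_apply_zero] at this
              exact absurd (hp₀ p (Finset.mem_univ _)) (not_le.2 this)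
          · rintro rfl i
            refine lt_of_le_of_ne ?_ fun he => ?_
            · simpa using hp₀ _ (Finset.mem_univ _)
            · exact (Fin.succ_ne_zero i) ((Equiv.injective _ (hs he)).symm)
      simp only [hrec]
      split_ifs with hp
      · exact ih ht fun k => f (k + 1)
      · exact ih ht f
    rw [← Equiv.sum_comp Equiv.Perm.decomposeFin.symm, Fintype.sum_prod_type]
    simp only [key]
    rw [← Finset.mul_sum, Finset.sum_ite, Finset.filter_eq', Finset.filter_ne']
    simp only [Finset.mem_univ, if_true, Finset.sum_const, Finset.card_singleton,
      Finset.card_erase_of_mem, Finset.card_univ, Fintype.card_fin, one_smul, nsmul_eq_mul,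
      recordMean, Nat.factorial_succ]
    push_cast
    field_simp
    ring

/-- The relative order of the values of a uniform permutation along `e` is uniform and independent
of every statistic `G` that is invariant under rearrangements of the range of `e`. -/
theorem sum_perm_mul_numRecords {n m : ℕ} (e : Fin m ↪ Fin n) (G : Equiv.Perm (Fin n) → ℂ)
    (hG : ∀ σ, ∀ h : Equiv.Perm (Fin m), G (σ * h.viaFintypeEmbedding e) = G σ) (f : ℕ → ℂ) :
    ∑ σ : Equiv.Perm (Fin n), G σ * f (numRecords (σ ∘ e)) =
      recordMean m f * ∑ σ : Equiv.Perm (Fin n), G σ := by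
  have hm : (m.factorial : ℂ) ≠ 0 := by exact_mod_cast m.factorial_ne_zero
  refine mul_left_cancel₀ hm ?_
  calc (m.factorial : ℂ) * ∑ σ : Equiv.Perm (Fin n), G σ * f (numRecords (σ ∘ e))
      = ∑ h : Equiv.Perm (Fin m), ∑ σ : Equiv.Perm (Fin n), G σ * f (numRecords (σ ∘ e)) := by
        simp [Fintype.card_perm]
    _ = ∑ h : Equiv.Perm (Fin m), ∑ σ : Equiv.Perm (Fin n),
          G σ * f (numRecords ((σ ∘ e) ∘ h)) := by
        refine Finset.sum_congr rfl fun h _ => ?_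
        rw [← Equiv.sum_comp (Equiv.mulRight (h.viaFintypeEmbedding e))]
        refine Finset.sum_congr rfl fun σ _ => ?_
        have : (⇑(σ * h.viaFintypeEmbedding e) ∘ e) = (σ ∘ e) ∘ h := by
          ext i
          simp
        simp only [Equiv.coe_mulRight, hG, this]
    _ = ∑ σ : Equiv.Perm (Fin n), G σ * (m.factorial * recordMean m f) := by
        rw [Finset.sum_comm]
        refine Finset.sum_congr rfl fun σ _ => ?_
        rw [← Finset.mul_sum, sum_perm_numRecords (σ.injective.comp e.injective)]
    _ = m.factorial * (recordMean m f * ∑ σ : Equiv.Perm (Fin n), G σ) := by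
        rw [← Finset.sum_mul]
        ring

theorem sum_perm_numRecords_comp {n m : ℕ} (e : Fin m ↪ Fin n) (f : ℕ → ℂ) :
    ∑ σ : Equiv.Perm (Fin n), f (numRecords (σ ∘ e)) = n.factorial * recordMean m f := by
  have h := sum_perm_mul_numRecords e (fun _ => 1) (fun _ _ => rfl) f
  simp only [one_mul, Finset.sum_const, Finset.card_univ, Fintype.card_perm, Fintype.card_fin,
    nsmul_eq_mul, mul_one] at h
  rw [h, mul_comm]

theorem sum_perm_numRecords_mul {n a b : ℕ} (e₁ : Fin a ↪ Fin n) (e₂ : Fin b ↪ Fin n)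
    (hd : ∀ i j, e₁ i ≠ e₂ j) (f g : ℕ → ℂ) :
    ∑ σ : Equiv.Perm (Fin n), f (numRecords (σ ∘ e₁)) * g (numRecords (σ ∘ e₂)) =
      n.factorial * (recordMean a f * recordMean b g) := by
  rw [sum_perm_mul_numRecords e₂ (fun σ => f (numRecords (σ ∘ e₁))) _ g,
    sum_perm_numRecords_comp]
  · ring
  · intro σ h
    have : (⇑(σ * h.viaFintypeEmbedding e₂) ∘ e₁) = σ ∘ e₁ := by
      ext i
      have hi : e₁ i ∉ Set.range e₂ := by
        rintro ⟨j, hj⟩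
        exact hd i j hj.symm
      simp [Equiv.Perm.viaFintypeEmbedding_apply_notMem_range _ _ hi]
    simp only [this]

theorem bstN_eq {n : ℕ} (l : Fin n) (π : Equiv.Perm (Fin n)) :
    bstN n (l + 1) π = (π.symm l : Fin n) + 1 := by
  have h : ∀ i : Fin n, ((π i : ℕ) + 1 = l + 1) ↔ i = π.symm l := fun i => by
    rw [Equiv.eq_symm_apply, Fin.ext_iff]
    omega
  simp only [bstN, h, Finset.sum_ite_eq', Finset.mem_univ, if_true]
  rw [add_comm]

/-- The keys `n, n - 1, …, n - m + 1`, in this order. -/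
def revEmb {m n : ℕ} (h : m ≤ n) : Fin m ↪ Fin n :=
  (Fin.castLEEmb h).trans Fin.revPerm.toEmbedding

theorem val_revEmb {m n : ℕ} (h : m ≤ n) (i : Fin m) : (revEmb h i : ℕ) = n - (i + 1) := rfl

theorem bstRminus_add_one {n : ℕ} (l : Fin n) (π : Equiv.Perm (Fin n)) :
    bstRminus n (l + 1) π + 1 = numRecords (π.symm ∘ Fin.castLEEmb (Nat.succ_le_of_lt l.isLt)) := by
  classical
  rw [numRecords, ← Finset.card_map (Fin.castLEEmb (Nat.succ_le_of_lt l.isLt)), bstRminus,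
    ← Finset.card_map π.toEmbedding, ← Finset.card_insert_of_notMem (a := l)]
  · congr 1
    ext j
    simp only [Finset.mem_insert, Finset.mem_map, Finset.mem_filter, Finset.mem_univ, true_and,
      bstN_eq, Function.comp_apply]
    constructor
    · rintro (rfl | ⟨r, ⟨h₁, h₂, h₃⟩, rfl⟩)
      · refine ⟨Fin.last _, fun i hi => absurd (Fin.le_last i) (not_le.2 hi), Fin.ext rfl⟩
      · refine ⟨⟨π r, by omega⟩, fun i hi => ?_, Fin.ext rfl⟩
        change π.symm (π r) < _
        rw [Equiv.symm_apply_apply]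
        set q := Fin.castLEEmb (Nat.succ_le_of_lt l.isLt) i with hq
        have hqi : (q : ℕ) = i := rfl
        have hri : (π r : ℕ) < i := hi
        have hi' := i.isLt
        by_cases hql : q = l
        · rw [hql, Fin.lt_def]
          omega
        · have hql' : (q : ℕ) ≠ l := fun h => hql (Fin.ext h)
          by_contra hle
          rcases lt_or_eq_of_le (not_lt.1 hle) with h | h
          · have := h₃ _ h (by rw [Equiv.apply_symm_apply]; omega)
            rw [Equiv.apply_symm_apply, Fin.lt_def] at this
            omega
          · rw [Equiv.symm_apply_eq] at h
            rw [← h] at hri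
            omega
    · rintro ⟨i, hi, rfl⟩
      by_cases hil : (i : ℕ) = l
      · exact Or.inl (Fin.ext hil)
      · refine Or.inr ⟨π.symm (Fin.castLEEmb (Nat.succ_le_of_lt l.isLt) i), ⟨?_, ?_, ?_⟩, by simp⟩
        · have := hi (Fin.last _) (Fin.lt_def.2 (by rw [Fin.val_last]; omega))
          have hl : Fin.castLEEmb (Nat.succ_le_of_lt l.isLt) (Fin.last _) = l := Fin.ext rfl
          rw [hl, Fin.lt_def] at this
          omega
        · rw [Equiv.apply_symm_apply]
          change (i : ℕ) + 1 < _
          omega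
        · intro k hk hkl
          rw [Equiv.apply_symm_apply]
          by_contra hle
          rcases lt_or_eq_of_le (not_lt.1 hle) with h | h
          · have := hi ⟨π k, by omega⟩ h
            have hk' : Fin.castLEEmb (Nat.succ_le_of_lt l.isLt) ⟨π k, by omega⟩ = π k := rfl
            rw [hk', Equiv.symm_apply_apply] at this
            exact lt_asymm hk this
          · rw [h, Equiv.symm_apply_apply] at hk
            exact lt_irrefl _ hk
  · simp only [Finset.mem_map, Finset.mem_filter, not_exists, not_and]
    rintro r ⟨-, -, h, -⟩ hr
    have : (π r : ℕ) = l := congrArg Fin.val hr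
    omega

theorem bstRplus_add_one {n m : ℕ} (l : Fin n) (hm : l + m = n) (hmn : m ≤ n)
    (π : Equiv.Perm (Fin n)) :
    bstRplus n (l + 1) π + 1 = numRecords (π.symm ∘ revEmb hmn) := by
  classical
  have hl := l.isLt
  rw [numRecords, ← Finset.card_map (revEmb hmn), bstRplus,
    ← Finset.card_map π.toEmbedding, ← Finset.card_insert_of_notMem (a := l)]
  · congr 1
    ext j
    simp only [Finset.mem_insert, Finset.mem_map, Finset.mem_filter, Finset.mem_univ, true_and,
      bstN_eq, Function.comp_apply]
    constructor
    · rintro (rfl | ⟨r, ⟨h₁, h₂, h₃⟩, rfl⟩)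
      · refine ⟨⟨m - 1, by omega⟩, fun i hi => ?_, Fin.ext (by rw [val_revEmb]; simp only; omega)⟩
        have := Fin.lt_def.1 hi
        simp only at this
        omega
      · have hr := (π r).isLt
        have hpr : revEmb hmn ⟨n - (π r + 1), by omega⟩ = π r :=
          Fin.ext (by rw [val_revEmb]; simp only; omega)
        refine ⟨⟨n - (π r + 1), by omega⟩, fun i hi => ?_, hpr⟩
        rw [hpr, Equiv.symm_apply_apply]
        set q := revEmb hmn i with hq
        have hqi : (q : ℕ) = n - (i + 1) := rfl
        have hri : n - (π r + 1) < i := hi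
        have hi' := i.isLt
        by_cases hql : q = l
        · rw [hql, Fin.lt_def]
          omega
        · have hql' : (q : ℕ) ≠ l := fun h => hql (Fin.ext h)
          by_contra hle
          rcases lt_or_eq_of_le (not_lt.1 hle) with h | h
          · have := h₃ _ h (by rw [Equiv.apply_symm_apply]; omega)
            rw [Equiv.apply_symm_apply, Fin.lt_def] at this
            omega
          · rw [Equiv.symm_apply_eq] at h
            rw [← h] at hri
            omega
    · rintro ⟨i, hi, rfl⟩
      have hi' := i.isLt
      by_cases hil : (i : ℕ) = m - 1
      · exact Or.inl (Fin.ext (by rw [val_revEmb]; omega))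
      · refine Or.inr ⟨π.symm (revEmb hmn i), ⟨?_, ?_, ?_⟩, by simp⟩
        · have := hi ⟨m - 1, by omega⟩ (Fin.lt_def.2 (by simp only; omega))
          have hl : revEmb hmn ⟨m - 1, by omega⟩ = l :=
            Fin.ext (by rw [val_revEmb]; simp only; omega)
          rw [hl, Fin.lt_def] at this
          omega
        · rw [Equiv.apply_symm_apply, val_revEmb]
          omega
        · intro k hk hkl
          rw [Equiv.apply_symm_apply]
          by_contra hle
          have hkn := (π k).isLt
          have hk' : revEmb hmn ⟨n - (π k + 1), by omega⟩ = π k :=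
            Fin.ext (by rw [val_revEmb]; simp only; omega)
          rcases lt_or_eq_of_le (not_lt.1 hle) with h | h
          · have := hi ⟨n - (π k + 1), by omega⟩ (Fin.lt_def.2 (by
              have := Fin.lt_def.1 h
              rw [val_revEmb] at this
              simp only
              omega))
            rw [hk', Equiv.symm_apply_apply] at this
            exact lt_asymm hk this
          · rw [← h, Equiv.symm_apply_apply] at hk
            exact lt_irrefl _ hk
  · simp only [Finset.mem_map, Finset.mem_filter, not_exists, not_and]
    rintro r ⟨-, -, h, -⟩ hr
    have : (π r : ℕ) = l := congrArg Fin.val hr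
    omega

instance (n : ℕ) : MeasurableSingletonClass (Equiv.Perm (Fin n)) := ⟨fun _ => trivial⟩

instance (n : ℕ) : IsProbabilityMeasure (uniformPerm n) := by
  unfold uniformPerm
  infer_instance

theorem integral_uniformPerm {E : Type*} [NormedAddCommGroup E] [NormedSpace ℝ E]
    [CompleteSpace E] {n : ℕ}
    (f : Equiv.Perm (Fin n) → E) :
    ∫ π, f π ∂(uniformPerm n) =
      (n.factorial : ℝ)⁻¹ • ∑ π : Equiv.Perm (Fin n), f π.symm := by
  have h : ∑ π : Equiv.Perm (Fin n), f π.symm = ∑ π, f π :=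
    Equiv.sum_comp (Equiv.inv (Equiv.Perm (Fin n))) f
  rw [h, uniformPerm, PMF.integral_eq_sum, Finset.smul_sum]
  simp [PMF.uniformOfFintype_apply, Fintype.card_perm]

/-- The number of records among the keys below `l` plus the number among the keys above `l`,
ignoring the position of `l` itself. -/
def decoupledDepth {n : ℕ} (l : Fin n) (π : Equiv.Perm (Fin n)) : ℕ :=
  numRecords (π.symm ∘ Fin.castLEEmb l.isLt.le) +
    numRecords (π.symm ∘ revEmb (Nat.sub_le n (l + 1)))

theorem bstDepth_le_decoupledDepth {n : ℕ} (l : Fin n) (π : Equiv.Perm (Fin n)) :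
    bstDepth n (l + 1) π ≤ decoupledDepth l π := by
  have h₁ := bstRminus_add_one l π
  have h₂ := numRecords_castSucc_le (π.symm ∘ Fin.castLEEmb (Nat.succ_le_of_lt l.isLt))
  have h₃ := bstRplus_add_one (m := n - (l + 1) + 1) l (by omega) (by omega) π
  have h₄ := numRecords_castSucc_le (π.symm ∘ revEmb (m := n - (l + 1) + 1) (n := n) (by omega))
  have h₅ : (π.symm ∘ Fin.castLEEmb (Nat.succ_le_of_lt l.isLt)) ∘ Fin.castSucc =
    π.symm ∘ Fin.castLEEmb l.isLt.le := rfl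
  have h₆ : (π.symm ∘ revEmb (m := n - (l + 1) + 1) (n := n) (by omega)) ∘ Fin.castSucc =
    π.symm ∘ revEmb (Nat.sub_le n (l + 1)) := rfl
  rw [h₅] at h₂
  rw [h₆] at h₄
  unfold bstDepth decoupledDepth
  omega

theorem integral_pow_decoupledDepth {n : ℕ} (l : Fin n) (z : ℂ) :
    ∫ π, z ^ decoupledDepth l π ∂(uniformPerm n) =
      (∏ i ∈ Finset.range l, (1 + (z - 1) / (i + 1))) *
        ∏ i ∈ Finset.range (n - (l + 1)), (1 + (z - 1) / (i + 1)) := by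
  have hn : (n.factorial : ℂ) ≠ 0 := by exact_mod_cast n.factorial_ne_zero
  rw [integral_uniformPerm]
  simp only [decoupledDepth, Equiv.symm_symm, pow_add]
  rw [sum_perm_numRecords_mul (Fin.castLEEmb l.isLt.le) (revEmb (Nat.sub_le n (l + 1))) _
    (fun k => z ^ k) (fun k => z ^ k), recordMean_pow, recordMean_pow, Complex.real_smul]
  · push_cast
    field_simp
  · intro i j h
    have := congrArg Fin.val h
    have h' : (i : ℕ) = n - (j + 1) := this
    omega

theorem integral_numRecords {n m : ℕ} (e : Fin m ↪ Fin n) :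
    ∫ π, (numRecords (π.symm ∘ e) : ℝ) ∂(uniformPerm n) = harm m := by
  have hn : (n.factorial : ℝ) ≠ 0 := by exact_mod_cast n.factorial_ne_zero
  have h := sum_perm_numRecords_comp e fun k => (k : ℂ)
  rw [recordMean_natCast] at h
  have h' : ∑ σ : Equiv.Perm (Fin n), (numRecords (σ ∘ e) : ℝ) = n.factorial * harm m := by
    exact_mod_cast h
  simp only [integral_uniformPerm, Equiv.symm_symm, h', smul_eq_mul]
  field_simp

theorem integral_decoupledDepth {n : ℕ} (l : Fin n) :
    ∫ π, (decoupledDepth l π : ℝ) ∂(uniformPerm n) = harm l + harm (n - (l + 1)) := by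
  simp only [decoupledDepth, Nat.cast_add]
  rw [integral_add .of_finite .of_finite, integral_numRecords, integral_numRecords]

theorem bstExp_eq {n : ℕ} (l : Fin n) :
    bstExp n (l + 1) = harm (l + 1) + harm (n - l) - 2 := by
  have h : ∀ π : Equiv.Perm (Fin n), (bstDepth n (l + 1) π : ℝ) =
      numRecords (π.symm ∘ Fin.castLEEmb (Nat.succ_le_of_lt l.isLt)) +
        numRecords (π.symm ∘ revEmb (Nat.sub_le n l)) - 2 := fun π => by
    rw [← bstRminus_add_one l π, ← bstRplus_add_one l (by omega) _ π, bstDepth]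
    push_cast
    ring
  simp only [bstExp, h]
  rw [integral_sub .of_finite .of_finite, integral_add .of_finite .of_finite,
    integral_numRecords, integral_numRecords]
  simp

theorem harm_succ (m : ℕ) : harm (m + 1) = harm m + 1 / (m + 1) := by
  simp [harm, Finset.sum_range_succ]

theorem harm_nonneg (m : ℕ) : 0 ≤ harm m :=
  Finset.sum_nonneg fun _ _ => by positivity

theorem log_add_one_le_harm (m : ℕ) : Real.log (m + 1) ≤ harm m := by
  have h : ((harmonic m : ℚ) : ℝ) = harm m := by
    simp [harmonic, harm]
  simpa [h] using log_add_one_le_harmonic m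

theorem norm_one_add_mul_sub_one_le {z : ℂ} (hz : ‖z‖ = 1) {p : ℝ} (h₀ : 0 ≤ p) (h₁ : p ≤ 1) :
    ‖1 + p * (z - 1)‖ ≤ 1 :=
  calc ‖1 + p * (z - 1)‖ = ‖((1 - p : ℝ) : ℂ) + p * z‖ := by
        congr 1
        push_cast
        ring
    _ ≤ ‖((1 - p : ℝ) : ℂ)‖ + ‖p * z‖ := norm_add_le _ _
    _ = 1 := by
        rw [norm_mul, hz, Complex.norm_real, Complex.norm_real, Real.norm_of_nonneg h₀,
          Real.norm_of_nonneg (by linarith)]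
        ring

theorem norm_exp_mul_sub_one_le {z : ℂ} (hz : ‖z‖ = 1) {p : ℝ} (h₀ : 0 ≤ p) :
    ‖Complex.exp (p * (z - 1))‖ ≤ 1 := by
  have h : z.re ≤ 1 := hz ▸ Complex.re_le_norm z
  rw [Complex.norm_exp, Real.exp_le_one_iff, Complex.re_ofReal_mul, Complex.sub_re,
    Complex.one_re]
  nlinarith

theorem norm_prod_one_add_le {z : ℂ} (hz : ‖z‖ = 1) (m : ℕ) :
    ‖∏ i ∈ Finset.range m, (1 + (z - 1) / (i + 1))‖ ≤ 1 := by
  rw [norm_prod]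
  refine Finset.prod_le_one (fun _ _ => norm_nonneg _) fun i _ => ?_
  have := norm_one_add_mul_sub_one_le hz (p := 1 / (i + 1)) (by positivity)
    (by rw [div_le_one (by positivity)]; linarith [(i.cast_nonneg : (0 : ℝ) ≤ i)])
  push_cast at this
  rwa [one_div_mul_eq_div] at this

theorem norm_mul_sub_mul_le {x y u v : ℂ} (hx : ‖x‖ ≤ 1) (hv : ‖v‖ ≤ 1) :
    ‖x * y - u * v‖ ≤ ‖x - u‖ + ‖y - v‖ :=
  calc ‖x * y - u * v‖ = ‖x * (y - v) + (x - u) * v‖ := by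
        congr 1
        ring
    _ ≤ ‖x‖ * ‖y - v‖ + ‖x - u‖ * ‖v‖ := by
        simpa only [norm_mul] using norm_add_le (x * (y - v)) ((x - u) * v)
    _ ≤ 1 * ‖y - v‖ + ‖x - u‖ * 1 := by gcongr
    _ = ‖x - u‖ + ‖y - v‖ := by ring

/-- The probability generating function of a sum of independent Bernoulli variables of parameters
`1, 1/2, …, 1/m` is close to that of the Poisson distribution of the same mean. -/
theorem norm_prod_sub_exp_le {z : ℂ} (hz : ‖z‖ = 1) (hz' : ‖z - 1‖ ≤ 1) (m : ℕ) :
    ‖∏ i ∈ Finset.range m, (1 + (z - 1) / (i + 1)) - Complex.exp (harm m * (z - 1))‖ ≤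
      ‖z - 1‖ ^ 2 * (2 - 2 / (m + 1)) := by
  induction m with
  | zero => simp [harm]
  | succ m ih =>
    have hm : (0 : ℝ) ≤ m := m.cast_nonneg
    have hm' : (0 : ℝ) < m + 1 := by positivity
    have hw : ‖(z - 1) / ((m : ℂ) + 1)‖ = ‖z - 1‖ / (m + 1) := by
      rw [norm_div]
      congr 1
      exact_mod_cast Complex.norm_natCast (m + 1)
    have hstep : ‖1 + (z - 1) / ((m : ℂ) + 1) - Complex.exp ((z - 1) / ((m : ℂ) + 1))‖ ≤
        ‖z - 1‖ ^ 2 * (1 / (m + 1) ^ 2) := by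
      rw [norm_sub_rev, ← sub_sub]
      refine (Complex.norm_exp_sub_one_sub_id_le ?_).trans_eq ?_
      · rw [hw, div_le_one hm']
        linarith
      · rw [hw, div_pow]
        ring
    have hexp : Complex.exp (harm (m + 1) * (z - 1)) =
        Complex.exp (harm m * (z - 1)) * Complex.exp ((z - 1) / ((m : ℂ) + 1)) := by
      rw [← Complex.exp_add, harm_succ]
      congr 1
      push_cast
      ring
    have hv : ‖Complex.exp ((z - 1) / ((m : ℂ) + 1))‖ ≤ 1 := by
      have := norm_exp_mul_sub_one_le hz (p := 1 / (m + 1)) (by positivity)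
      push_cast at this
      rwa [one_div_mul_eq_div] at this
    rw [Finset.prod_range_succ, hexp]
    refine (norm_mul_sub_mul_le (norm_prod_one_add_le hz m) hv).trans
      ((add_le_add ih hstep).trans ?_)
    rw [← mul_add]
    refine mul_le_mul_of_nonneg_left ?_ (by positivity)
    push_cast
    have : 1 / ((m : ℝ) + 1) ^ 2 ≤ 2 / (m + 1) - 2 / (m + 1 + 1) := by
      rw [div_sub_div _ _ hm'.ne' (by positivity), div_le_div_iff₀ (by positivity) (by positivity)]
      nlinarith
    linarith

theorem norm_prod_mul_prod_sub_exp_le {z : ℂ} (hz : ‖z‖ = 1) (hz' : ‖z - 1‖ ≤ 1) (a b : ℕ) :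
    ‖(∏ i ∈ Finset.range a, (1 + (z - 1) / (i + 1))) *
        (∏ i ∈ Finset.range b, (1 + (z - 1) / (i + 1))) -
        Complex.exp ((harm a + harm b : ℝ) * (z - 1))‖ ≤ 4 * ‖z - 1‖ ^ 2 := by
  have hb : ∀ m : ℕ, ‖z - 1‖ ^ 2 * (2 - 2 / ((m : ℝ) + 1)) ≤ ‖z - 1‖ ^ 2 * 2 := fun m => by
    refine mul_le_mul_of_nonneg_left ?_ (by positivity)
    have : (0 : ℝ) ≤ 2 / ((m : ℝ) + 1) := by positivity
    linarith
  have h : Complex.exp ((harm a + harm b : ℝ) * (z - 1)) =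
      Complex.exp (harm a * (z - 1)) * Complex.exp (harm b * (z - 1)) := by
    rw [← Complex.exp_add]
    congr 1
    push_cast
    ring
  rw [h]
  have := norm_mul_sub_mul_le (norm_prod_one_add_le hz a)
    (norm_exp_mul_sub_one_le hz (harm_nonneg b))
    (y := ∏ i ∈ Finset.range b, (1 + (z - 1) / (i + 1)))
    (u := Complex.exp (harm a * (z - 1)))
  linarith [norm_prod_sub_exp_le hz hz' a, norm_prod_sub_exp_le hz hz' b, hb a, hb b]

/-- A standardised Poisson-like generating function converges to the Gaussian characteristic
function as the parameter tends to infinity. -/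
theorem tendsto_exp_poisson {μ ν : ℕ → ℝ} (hμ : Tendsto μ atTop atTop)
    (hν : ∀ᶠ n in atTop, |ν n - μ n| ≤ 2) (t : ℝ) :
    Tendsto (fun n => Complex.exp (ν n * (Complex.exp (Complex.I * (t / √(μ n) : ℝ)) - 1) -
      Complex.I * (t / √(μ n) : ℝ) * μ n)) atTop (nhds (Complex.exp (-(t ^ 2 / 2 : ℝ)))) := by
  have hsq : Tendsto (fun n => √(μ n)) atTop atTop := Real.tendsto_sqrt_atTop.comp hμ
  have hθ : Tendsto (fun n => t / √(μ n)) atTop (nhds 0) := hsq.const_div_atTop t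
  refine (Complex.continuous_exp.tendsto _).comp (tendsto_iff_norm_sub_tendsto_zero.2 ?_)
  have hlim : Tendsto (fun n => 2 * |t / √(μ n)| + t ^ 2 * |t / √(μ n)|) atTop (nhds 0) := by
    have := (hθ.abs.const_mul 2).add (hθ.abs.const_mul (t ^ 2))
    simpa using this
  refine squeeze_zero' (Eventually.of_forall fun _ => norm_nonneg _) ?_ hlim
  filter_upwards [hν, hμ.eventually_gt_atTop 0, hθ.abs.eventually_le_const (u := 1) (by simp)]
    with n hn hpos hsmall
  set θ := t / √(μ n) with hθdef
  have hμθ : μ n * θ ^ 2 = t ^ 2 := by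
    rw [hθdef, div_pow, Real.sq_sqrt hpos.le]
    field_simp
  have hμθ' : (μ n : ℂ) * (θ : ℂ) ^ 2 = (t : ℂ) ^ 2 := by exact_mod_cast hμθ
  have hnorm : ‖Complex.I * (θ : ℂ)‖ = |θ| := by simp
  have hb := Complex.exp_bound (x := Complex.I * θ) (by rwa [hnorm]) (n := 3) (by norm_num)
  rw [hnorm] at hb
  have hsum : ∑ m ∈ Finset.range 3, (Complex.I * (θ : ℂ)) ^ m / (m.factorial : ℂ) =
      1 + Complex.I * θ - θ ^ 2 / 2 := by
    simp only [Finset.sum_range_succ, Finset.sum_range_zero, mul_pow, Complex.I_sq]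
    norm_num [Nat.factorial]
    ring
  rw [hsum] at hb
  have hdecomp : (ν n : ℂ) * (Complex.exp (Complex.I * θ) - 1) - Complex.I * θ * μ n -
      -((t ^ 2 / 2 : ℝ) : ℂ) = ((ν n - μ n : ℝ) : ℂ) * (Complex.exp (Complex.I * θ) - 1) +
        μ n * (Complex.exp (Complex.I * θ) - (1 + Complex.I * θ - θ ^ 2 / 2)) := by
    push_cast
    rw [← hμθ']
    ring
  rw [hdecomp]
  refine (norm_add_le _ _).trans (add_le_add ?_ ?_)
  · rw [norm_mul, Complex.norm_real]
    exact mul_le_mul hn Real.norm_exp_I_mul_ofReal_sub_one_le (norm_nonneg _) zero_le_two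
  · rw [norm_mul, Complex.norm_real, Real.norm_of_nonneg hpos.le]
    calc μ n * _ ≤ μ n * (|θ| ^ 3 * 1) := by
          refine mul_le_mul_of_nonneg_left (hb.trans ?_) hpos.le
          refine mul_le_mul_of_nonneg_left ?_ (by positivity)
          norm_num [Nat.factorial]
      _ = (μ n * |θ| ^ 2) * |θ| := by ring
      _ = t ^ 2 * |θ| := by rw [sq_abs, hμθ]

theorem log_sub_two_le_bstExp {n : ℕ} (l : Fin n) : Real.log n - 2 ≤ bstExp n (l + 1) := by
  have hl := l.isLt
  have h₁ := log_add_one_le_harm (l + 1)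
  have h₂ := log_add_one_le_harm (n - l)
  have h₃ : Real.log n ≤ Real.log ((l + 1 : ℕ) + 1) + Real.log ((n - l : ℕ) + 1) := by
    rw [← Real.log_mul (by positivity) (by positivity)]
    refine Real.log_le_log (by exact_mod_cast (by omega : 0 < n)) ?_
    have : n = l + (n - l) := by omega
    have h : n ≤ (l + 1 + 1) * (n - l + 1) := by nlinarith
    exact_mod_cast h
  rw [bstExp_eq]
  linarith

theorem harm_add_harm_sub_bstExp_mem {n : ℕ} (l : Fin n) :
    0 ≤ harm l + harm (n - (l + 1)) - bstExp n (l + 1) ∧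
      harm l + harm (n - (l + 1)) - bstExp n (l + 1) ≤ 2 := by
  have hl := l.isLt
  have h : n - l = n - (l + 1) + 1 := by omega
  have key : ∀ m : ℕ, 0 ≤ 1 / ((m : ℝ) + 1) ∧ 1 / ((m : ℝ) + 1) ≤ 1 := fun m =>
    ⟨by positivity, by rw [div_le_one (by positivity)]; linarith [(m.cast_nonneg : (0 : ℝ) ≤ m)]⟩
  rw [bstExp_eq, h, harm_succ, harm_succ]
  constructor <;> linarith [key l, key (n - (l + 1))]

theorem norm_integral_exp_sub_integral_exp_le {n : ℕ} (l : Fin n) (θ : ℝ) :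
    ‖∫ π, Complex.exp (Complex.I * θ) ^ bstDepth n (l + 1) π ∂(uniformPerm n) -
      ∫ π, Complex.exp (Complex.I * θ) ^ decoupledDepth l π ∂(uniformPerm n)‖ ≤ 2 * |θ| := by
  rw [← integral_sub .of_finite .of_finite]
  have hpt : ∀ π, ‖Complex.exp (Complex.I * θ) ^ bstDepth n (l + 1) π -
      Complex.exp (Complex.I * θ) ^ decoupledDepth l π‖ ≤
        |θ| * ((decoupledDepth l π : ℝ) - bstDepth n (l + 1) π) := fun π => by
    obtain ⟨d, hd⟩ := Nat.exists_eq_add_of_le (bstDepth_le_decoupledDepth l π)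
    have h₁ : ∀ k : ℕ, Complex.exp (Complex.I * θ) ^ k =
        Complex.exp (Complex.I * (k * θ : ℝ)) := fun k => by
      rw [← Complex.exp_nat_mul]
      congr 1
      push_cast
      ring
    have h₂ : ∀ x : ℝ, ‖Complex.exp (Complex.I * x)‖ = 1 := fun x => by
      rw [mul_comm, Complex.norm_exp_ofReal_mul_I]
    have h₃ : ((decoupledDepth l π : ℝ) - bstDepth n (l + 1) π) = d := by
      rw [hd]
      push_cast
      ring
    rw [norm_sub_rev, h₃, hd, pow_add, ← mul_sub_one, norm_mul, norm_pow, h₂, one_pow, one_mul, h₁]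
    refine Real.norm_exp_I_mul_ofReal_sub_one_le.trans_eq ?_
    rw [Real.norm_eq_abs, abs_mul, Nat.abs_cast, mul_comm]
  refine (norm_integral_le_of_norm_le (.of_finite) (Eventually.of_forall hpt)).trans ?_
  rw [integral_const_mul, integral_sub .of_finite .of_finite, integral_decoupledDepth, mul_comm]
  exact mul_le_mul_of_nonneg_right (harm_add_harm_sub_bstExp_mem l).2 (abs_nonneg θ)

/-- The depth of the node `l`, centred by its mean and scaled by the square root of its mean. -/
noncomputable def normalizedDepth (n l : ℕ) (π : Equiv.Perm (Fin n)) : ℝ :=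
  ((bstDepth n l π : ℝ) - bstExp n l) / √(bstExp n l)

theorem charFun_normalizedDepth {n l : ℕ} (hpos : 0 < bstExp n l) (t : ℝ) :
    charFun ((uniformPerm n).map (normalizedDepth n l)) t =
      Complex.exp (-(Complex.I * (t / √(bstExp n l) : ℝ) * bstExp n l)) *
        ∫ π, Complex.exp (Complex.I * (t / √(bstExp n l) : ℝ)) ^ bstDepth n l π
          ∂(uniformPerm n) := by
  rw [charFun_apply_real, integral_map (Measurable.of_discrete).aemeasurable
    (by fun_prop), ← integral_const_mul]
  refine integral_congr_ae (Eventually.of_forall fun π => ?_)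
  simp only [normalizedDepth]
  rw [← Complex.exp_nat_mul, ← Complex.exp_add]
  congr 1
  have : (√(bstExp n l) : ℂ) ≠ 0 := by exact_mod_cast (Real.sqrt_pos.2 hpos).ne'
  push_cast
  field_simp
  ring

theorem tendsto_charFun_normalizedDepth {l : ℕ → ℕ}
    (hl : ∀ n, 1 ≤ n → l n ∈ Finset.Icc 1 n) (t : ℝ) :
    Tendsto (fun n => charFun ((uniformPerm n).map (normalizedDepth n (l n))) t) atTop
      (nhds (Complex.exp (-(t ^ 2 / 2 : ℝ)))) := by
  have hfin : ∀ n, 1 ≤ n → ∃ k : Fin n, l n = k + 1 := fun n hn => by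
    have := Finset.mem_Icc.1 (hl n hn)
    exact ⟨⟨l n - 1, by omega⟩, by simp only; omega⟩
  have hμ : Tendsto (fun n => bstExp n (l n)) atTop atTop := by
    refine tendsto_atTop_mono' atTop ?_ (tendsto_atTop_add_const_right atTop (-2 : ℝ)
      (Real.tendsto_log_atTop.comp tendsto_natCast_atTop_atTop))
    filter_upwards [eventually_ge_atTop 1] with n hn
    obtain ⟨k, hk⟩ := hfin n hn
    rw [hk]
    exact log_sub_two_le_bstExp k
  set ν : ℕ → ℝ := fun n => harm (l n - 1) + harm (n - l n) with hν
  have hθ : Tendsto (fun n => t / √(bstExp n (l n))) atTop (nhds 0) :=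
    (Real.tendsto_sqrt_atTop.comp hμ).const_div_atTop t
  have hmain := tendsto_exp_poisson (ν := ν) hμ (by
    filter_upwards [eventually_ge_atTop 1] with n hn
    obtain ⟨k, hk⟩ := hfin n hn
    obtain ⟨h₁, h₂⟩ := harm_add_harm_sub_bstExp_mem k
    simp only [hν, hk, Nat.add_sub_cancel]
    rwa [abs_of_nonneg h₁]) t
  refine hmain.congr_dist ?_
  have hlim : Tendsto (fun n => 2 * |t / √(bstExp n (l n))| + 4 * |t / √(bstExp n (l n))| ^ 2)
      atTop (nhds 0) := by
    have := (hθ.abs.const_mul 2).add ((hθ.abs.pow 2).const_mul 4)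
    simpa using this
  refine squeeze_zero' (Eventually.of_forall fun _ => dist_nonneg) ?_ hlim
  filter_upwards [eventually_ge_atTop 1, hμ.eventually_gt_atTop 0,
    hθ.abs.eventually_le_const (u := 1) (by simp)] with n hn hpos hsmall
  rw [charFun_normalizedDepth hpos]
  set θ := t / √(bstExp n (l n))
  obtain ⟨k, hk⟩ := hfin n hn
  have hz : ‖Complex.exp (Complex.I * θ)‖ = 1 := by
    rw [mul_comm, Complex.norm_exp_ofReal_mul_I]
  have hz' : ‖Complex.exp (Complex.I * θ) - 1‖ ≤ |θ| := Real.norm_exp_I_mul_ofReal_sub_one_le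
  have hunit : ‖Complex.exp (-(Complex.I * θ * bstExp n (l n)))‖ = 1 := by
    have : -(Complex.I * θ * bstExp n (l n)) = ((-(θ * bstExp n (l n)) : ℝ) : ℂ) * Complex.I := by
      push_cast
      ring
    rw [this, Complex.norm_exp_ofReal_mul_I]
  have h₁ := norm_integral_exp_sub_integral_exp_le k θ
  rw [integral_pow_decoupledDepth, ← hk] at h₁
  have h₂ := norm_prod_mul_prod_sub_exp_le hz (hz'.trans hsmall) k (n - (k + 1))
  have hνk : harm k + harm (n - (k + 1)) = ν n := by simp [hν, hk]
  rw [hνk] at h₂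
  have h₃ : ‖Complex.exp (Complex.I * θ) - 1‖ ^ 2 ≤ |θ| ^ 2 := by gcongr
  rw [dist_comm, dist_eq_norm, sub_eq_neg_add (ν n * _ : ℂ), Complex.exp_add, ← mul_sub, norm_mul,
    hunit, one_mul]
  rw [hk] at h₁ ⊢
  refine (norm_sub_le_norm_sub_add_norm_sub _ _ _).trans (add_le_add h₁ (h₂.trans ?_))
  linarith

theorem gaussianReal_Iic_toReal (x : ℝ) :
    (gaussianReal 0 1 (Set.Iic x)).toReal = stdNormalCDF x := by
  rw [gaussianReal_apply_eq_integral 0 one_ne_zero, ENNReal.toReal_ofReal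
    (integral_nonneg fun _ => gaussianPDFReal_nonneg _ _ _), stdNormalCDF, ← integral_const_mul]
  simp [gaussianPDFReal]

theorem depth_asymptotic_normality (l : ℕ → ℕ) (hl : ∀ n, 1 ≤ n → l n ∈ Finset.Icc 1 n) :
    ∀ x : ℝ,
      Filter.Tendsto (fun n : ℕ =>
          ((uniformPerm n) {π | ((bstDepth n (l n) π : ℝ) - bstExp n (l n))
              / Real.sqrt (bstExp n (l n)) ≤ x}).toReal)
        Filter.atTop (nhds (stdNormalCDF x)) := by
  intro x
  have hprob : ∀ n, IsProbabilityMeasure ((uniformPerm n).map (normalizedDepth n (l n))) :=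
    fun n => Measure.isProbabilityMeasure_map (Measurable.of_discrete).aemeasurable
  let P : ℕ → ProbabilityMeasure ℝ := fun n => ⟨_, hprob n⟩
  let γ : ProbabilityMeasure ℝ := ⟨gaussianReal 0 1, inferInstance⟩
  have hP : Tendsto P atTop (nhds γ) := by
    refine ProbabilityMeasure.tendsto_of_tendsto_charFun fun t => ?_
    have h : charFun (γ : Measure ℝ) t = Complex.exp (-(t ^ 2 / 2 : ℝ)) := by
      change charFun (gaussianReal 0 1) t = _
      rw [charFun_gaussianReal]
      congr 1
      push_cast
      ring
    rw [h]
    exact tendsto_charFun_normalizedDepth hl t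
  have hlim := ProbabilityMeasure.tendsto_measure_of_null_frontier_of_tendsto' hP
    (E := Set.Iic x) (by
      rw [frontier_Iic]
      exact (nullSingletonClass_gaussianReal one_ne_zero).measure_singleton x)
  have hlim' := (ENNReal.tendsto_toReal (measure_ne_top _ _)).comp hlim
  have hγ : ((γ : Measure ℝ) (Set.Iic x)).toReal = stdNormalCDF x := gaussianReal_Iic_toReal x
  rw [hγ] at hlim'
  refine hlim'.congr fun n => ?_
  change ((uniformPerm n).map (normalizedDepth n (l n)) (Set.Iic x)).toReal = _
  rw [Measure.map_apply Measurable.of_discrete measurableSet_Iic]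
  rfl
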